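/- Assume (A0) and fix integers a, b ≥ 1. Then there exist constants 0 < c ≤ C < ∞ (depending on w, a, b) such that for every integer ℓ ≥ min(a,b), c/w(ℓ) ≤ P^{a,b}(Z_∞ = ℓ) ≤ C/w(ℓ). -/

import Mathlib

/-!
Statement 0 (Proposition 2(a) of Cotar–Limic, "Attraction time for strongly
reinforced walks").

Setup: `w : ℕ → ℝ` is a reinforcement weight function, positive on `{1,2,...}`,
satisfying (A0): `∑_{k ≥ 1} 1/w(k) < ∞`.  The two-edge ERRW with law `P^{a,b}`
is the Markov chain `(G_n, R_n)_{n ≥ a+b}` with `(G_{a+b}, R_{a+b}) = (a,b)`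
which moves from `(g,r)` to `(g+1,r)` with probability `w(g)/(w(g)+w(r))` and to
`(g,r+1)` with probability `w(r)/(w(g)+w(r))`.  We encode a trajectory by the
sequence of choices `ω : ℕ → Bool` (`true` = green edge incremented), and we
characterize the law `P` by its values on cylinder sets.
-/

open MeasureTheory Finset

namespace AttractionTime

/-- Number of green increments among the first `i` steps. -/
def greenCount (ω : ℕ → Bool) (i : ℕ) : ℕ :=
  ((Finset.range i).filter fun j => ω j = true).card

/-- Green edge weight after `i` steps, starting from `a`. -/
def Gw (a : ℕ) (ω : ℕ → Bool) (i : ℕ) : ℕ := a + greenCount ω i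

/-- Red edge weight after `i` steps, starting from `b`. -/
def Rw (b : ℕ) (ω : ℕ → Bool) (i : ℕ) : ℕ := b + (i - greenCount ω i)

/-- Transition probability of the `i`-th step of the trajectory `s`. -/
noncomputable def stepProb (w : ℕ → ℝ) (a b : ℕ) (s : ℕ → Bool) (i : ℕ) : ℝ :=
  if s i then w (Gw a s i) / (w (Gw a s i) + w (Rw b s i))
  else w (Rw b s i) / (w (Gw a s i) + w (Rw b s i))

/-- `Z_n = min (G_n, R_n)`, where time `n ≥ a+b` corresponds to `n - (a+b)` steps. -/
def Z (a b : ℕ) (ω : ℕ → Bool) (n : ℕ) : ℕ :=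
  min (Gw a ω (n - (a + b))) (Rw b ω (n - (a + b)))

/-- `Z_∞ = sup_n Z_n ∈ ℕ ∪ {∞}`. -/
noncomputable def Zinf (a b : ℕ) (ω : ℕ → Bool) : ℕ∞ := ⨆ n, (Z a b ω n : ℕ∞)

/-- The law `P^{a,b}` : a probability measure on trajectories whose cylinder
probabilities are the products of the transition probabilities. -/
def IsTwoEdgeLaw (w : ℕ → ℝ) (a b : ℕ) (P : Measure (ℕ → Bool)) : Prop :=
  ∀ (m : ℕ) (s : ℕ → Bool),
    (P {ω | ∀ i < m, ω i = s i}).toReal = ∏ i ∈ Finset.range m, stepProb w a b s i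

end AttractionTime

open AttractionTime

namespace AttractionTime

lemma greenCount_succ (ω : ℕ → Bool) (i : ℕ) :
    greenCount ω (i + 1) = greenCount ω i + if ω i = true then 1 else 0 := by
  unfold greenCount
  rw [Finset.range_add_one, Finset.filter_insert]
  split_ifs with h <;> simp

lemma greenCount_le (ω : ℕ → Bool) (i : ℕ) : greenCount ω i ≤ i := by
  simpa [greenCount] using Finset.card_filter_le (Finset.range i) (fun j => ω j = true)

lemma greenCount_congr {ω s : ℕ → Bool} {m : ℕ} (h : ∀ i < m, ω i = s i) :
    greenCount ω m = greenCount s m := by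
  unfold greenCount
  congr 1
  exact Finset.filter_congr fun i hi => by rw [h i (Finset.mem_range.1 hi)]

lemma Gw_congr (a : ℕ) {ω s : ℕ → Bool} {m : ℕ} (h : ∀ i < m, ω i = s i) :
    Gw a ω m = Gw a s m := by
  rw [Gw, Gw, greenCount_congr h]

lemma Rw_congr (b : ℕ) {ω s : ℕ → Bool} {m : ℕ} (h : ∀ i < m, ω i = s i) :
    Rw b ω m = Rw b s m := by
  rw [Rw, Rw, greenCount_congr h]

lemma Gw_succ (a : ℕ) (ω : ℕ → Bool) (i : ℕ) :
    Gw a ω (i + 1) = Gw a ω i + if ω i = true then 1 else 0 := by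
  rw [Gw, Gw, greenCount_succ, add_assoc]

lemma Rw_succ (b : ℕ) (ω : ℕ → Bool) (i : ℕ) :
    Rw b ω (i + 1) = Rw b ω i + if ω i = true then 0 else 1 := by
  have := greenCount_le ω i
  rw [Rw, Rw, greenCount_succ]
  split_ifs <;> omega

lemma Gw_add_Rw (a b : ℕ) (ω : ℕ → Bool) (i : ℕ) : Gw a ω i + Rw b ω i = a + b + i := by
  have := greenCount_le ω i
  rw [Gw, Rw]
  omega

lemma measurable_greenCount (i : ℕ) : Measurable fun ω : ℕ → Bool => greenCount ω i := by
  induction i with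
  | zero => simp [greenCount]
  | succ i ih =>
    simp_rw [greenCount_succ]
    refine ih.add (Measurable.ite ?_ measurable_const measurable_const)
    exact measurableSet_eq_fun (measurable_pi_apply i) measurable_const

/-- The probability that the two-edge walk started from `(k, r)` lies in `Q` after `n` steps,
defined by first-step analysis. -/
noncomputable def hitProb (w : ℕ → ℝ) (Q : ℕ → ℕ → Prop) : ℕ → ℕ → ℕ → ℝ
  | 0, k, r => open Classical in if Q k r then 1 else 0
  | n + 1, k, r =>
    (w k * hitProb w Q n (k + 1) r + w r * hitProb w Q n k (r + 1)) / (w k + w r)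

section hitProb

variable {w : ℕ → ℝ} {Q : ℕ → ℕ → Prop}

lemma hitProb_swap (n k r : ℕ) :
    hitProb w (fun x y => Q y x) n r k = hitProb w Q n k r := by
  induction n generalizing k r with
  | zero => rfl
  | succ n ih => rw [hitProb, hitProb, ih, ih, add_comm, add_comm (w r)]

lemma hitProb_nonneg (hw : ∀ k, 1 ≤ k → 0 < w k) (n : ℕ) {k r : ℕ} (hk : 1 ≤ k) (hr : 1 ≤ r) :
    0 ≤ hitProb w Q n k r := by
  induction n generalizing k r with
  | zero => rw [hitProb]; split_ifs <;> norm_num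
  | succ n ih =>
    have := hw k hk
    have := hw r hr
    have := ih (k := k + 1) (by omega) hr
    have := ih (r := r + 1) hk (by omega)
    rw [hitProb]
    positivity

lemma hitProb_le_one (hw : ∀ k, 1 ≤ k → 0 < w k) (n : ℕ) {k r : ℕ} (hk : 1 ≤ k) (hr : 1 ≤ r) :
    hitProb w Q n k r ≤ 1 := by
  induction n generalizing k r with
  | zero => rw [hitProb]; split_ifs <;> norm_num
  | succ n ih =>
    have h1 := hw k hk
    have h2 := hw r hr
    have h3 := ih (k := k + 1) (by omega) hr
    have h4 := ih (r := r + 1) hk (by omega)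
    rw [hitProb, div_le_one (by positivity)]
    nlinarith

lemma hitProb_eq_zero_of_lt {g : ℕ} (n : ℕ) {k : ℕ} (r : ℕ) (hk : g < k) :
    hitProb w (fun x _ => x = g) n k r = 0 := by
  induction n generalizing k r with
  | zero => rw [hitProb, if_neg (by omega)]
  | succ n ih => rw [hitProb, ih _ (by omega), ih _ hk]; simp

lemma hitProb_eq_zero_of_add_lt {g n k : ℕ} (r : ℕ) (hk : k + n < g) :
    hitProb w (fun x _ => x = g) n k r = 0 := by
  induction n generalizing k r with
  | zero => rw [hitProb, if_neg (by omega)]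
  | succ n ih => rw [hitProb, ih _ (by omega), ih _ (by omega)]; simp

end hitProb

lemma mul_exp_neg_sum_le {f x : ℕ → ℝ} {a k : ℕ} (hak : a ≤ k)
    (h : ∀ i, a ≤ i → i < k → f (i + 1) * Real.exp (-x i) ≤ f i) :
    f k * Real.exp (-∑ i ∈ Finset.Ico a k, x i) ≤ f a := by
  induction k, hak using Nat.le_induction with
  | base => simp
  | succ k hak ih =>
    rw [Finset.sum_Ico_succ_top hak, neg_add, Real.exp_add, mul_comm (Real.exp _), ← mul_assoc]
    refine le_trans ?_ (ih fun i hi hik => h i hi (by omega))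
    gcongr
    exact h k hak (by omega)

lemma le_exp_mul_of_mul_exp_neg_sum_le {w : ℕ → ℝ} {x y p S : ℝ} {s : Finset ℕ} (hx : 0 ≤ x)
    (hy : 0 ≤ y) (hS : ∑ l ∈ s, 1 / w l ≤ S) (h : y * Real.exp (-∑ l ∈ s, x / w l) ≤ p) :
    y ≤ Real.exp (x * S) * p := by
  have h1 : ∑ l ∈ s, x / w l ≤ x * S := by
    simp_rw [div_eq_mul_one_div x, ← Finset.mul_sum]
    gcongr
  have h2 : y * Real.exp (-(x * S)) ≤ p := le_trans (by gcongr) h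
  rwa [Real.exp_neg, ← div_eq_mul_inv, div_le_iff₀' (Real.exp_pos _)] at h2

lemma exp_neg_div_le {x y : ℝ} (hx : 0 < x) (hy : 0 < y) : Real.exp (-(y / x)) ≤ x / (x + y) := by
  rw [Real.exp_neg, ← one_div, div_le_div_iff₀ (Real.exp_pos _) (by positivity)]
  have := Real.add_one_le_exp (y / x)
  have h : x + y = x * (y / x + 1) := by field_simp; ring
  rw [h, one_mul]
  gcongr

/-- The probability that the walk started from `(k, r)` visits `(g, N)`, where `T = g + N`. -/
noncomputable def visitProb (w : ℕ → ℝ) (g T k r : ℕ) : ℝ :=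
  hitProb w (fun x _ => x = g) (T - (k + r)) k r

section visitProb

variable {w : ℕ → ℝ} {g N T k r : ℕ}

lemma visitProb_nonneg (hw : ∀ k, 1 ≤ k → 0 < w k) (hk : 1 ≤ k) (hr : 1 ≤ r) :
    0 ≤ visitProb w g T k r := hitProb_nonneg hw _ hk hr

lemma visitProb_le_one (hw : ∀ k, 1 ≤ k → 0 < w k) (hk : 1 ≤ k) (hr : 1 ≤ r) :
    visitProb w g T k r ≤ 1 := hitProb_le_one hw _ hk hr

lemma visitProb_eq (hT : k + r < T) :
    visitProb w g T k r =
      (w k * visitProb w g T (k + 1) r + w r * visitProb w g T k (r + 1)) / (w k + w r) := by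
  unfold visitProb
  obtain ⟨n, rfl⟩ : ∃ n, T = n + 1 + (k + r) := ⟨T - (k + r) - 1, by omega⟩
  rw [show n + 1 + (k + r) - (k + r) = n + 1 by omega,
    show n + 1 + (k + r) - (k + 1 + r) = n by omega,
    show n + 1 + (k + r) - (k + (r + 1)) = n by omega, hitProb]

lemma visitProb_self : visitProb w g (g + N) g N = 1 := by
  simp [visitProb, hitProb]

lemma visitProb_succ_left_mul_exp_le (hw : ∀ k, 1 ≤ k → 0 < w k) (hk : 1 ≤ k) (hr : 1 ≤ r)
    (hT : k + r < T) :
    visitProb w g T (k + 1) r * Real.exp (-(w r / w k)) ≤ visitProb w g T k r := by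
  have h1 := hw k hk
  have h2 := hw r hr
  have h3 : 0 ≤ visitProb w g T (k + 1) r := visitProb_nonneg hw (by omega) hr
  have h4 : 0 ≤ visitProb w g T k (r + 1) := visitProb_nonneg hw hk (by omega)
  calc _ ≤ visitProb w g T (k + 1) r * (w k / (w k + w r)) := by
        gcongr; exact exp_neg_div_le h1 h2
    _ = (w k * visitProb w g T (k + 1) r + 0) / (w k + w r) := by ring
    _ ≤ _ := by rw [visitProb_eq hT]; gcongr; positivity

lemma visitProb_succ_right_mul_exp_le (hw : ∀ k, 1 ≤ k → 0 < w k) (hk : 1 ≤ k) (hr : 1 ≤ r)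
    (hT : k + r < T) :
    visitProb w g T k (r + 1) * Real.exp (-(w k / w r)) ≤ visitProb w g T k r := by
  have h1 := hw k hk
  have h2 := hw r hr
  have h3 : 0 ≤ visitProb w g T (k + 1) r := visitProb_nonneg hw (by omega) hr
  have h4 : 0 ≤ visitProb w g T k (r + 1) := visitProb_nonneg hw hk (by omega)
  calc _ ≤ visitProb w g T k (r + 1) * (w r / (w r + w k)) := by
        gcongr; exact exp_neg_div_le h2 h1
    _ = (0 + w r * visitProb w g T k (r + 1)) / (w k + w r) := by ring
    _ ≤ _ := by rw [visitProb_eq hT]; gcongr; positivity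

lemma visitProb_top_le (hw : ∀ k, 1 ≤ k → 0 < w k) (hk : 1 ≤ k) (hN : 1 ≤ N) (hkg : k < g) :
    visitProb w g (g + N) k N / w k ≤ 1 / w N := by
  have h1 := hw k hk
  have h2 := hw N hN
  have h3 : visitProb w g (g + N) (k + 1) N ≤ 1 := visitProb_le_one hw (by omega) hN
  have h4 : visitProb w g (g + N) k (N + 1) = 0 := hitProb_eq_zero_of_add_lt _ (by omega)
  rw [visitProb_eq (by omega), h4, mul_zero, add_zero, div_div,
    div_le_div_iff₀ (by positivity) h2]
  have : w k * visitProb w g (g + N) (k + 1) N ≤ w k * 1 := by gcongr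
  nlinarith [mul_le_mul_of_nonneg_right this h2.le, mul_pos h1 h1]

lemma sum_visitProb_succ (hw : ∀ k, 1 ≤ k → 0 < w k) {a : ℕ} (ha : 1 ≤ a) (hr : 1 ≤ r)
    (hag : a ≤ g) (hrN : r < N) :
    ∑ k ∈ Finset.Ico a (g + 1), visitProb w g (g + N) k (r + 1) / w k =
      ∑ k ∈ Finset.Ico a (g + 1), visitProb w g (g + N) k r / w k +
        visitProb w g (g + N) a r / w r := by
  have hz : visitProb w g (g + N) (g + 1) r = 0 := hitProb_eq_zero_of_lt _ _ (by omega)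
  have key : ∀ k ∈ Finset.Ico a (g + 1),
      visitProb w g (g + N) k (r + 1) / w k = visitProb w g (g + N) k r / w k +
        -((visitProb w g (g + N) (k + 1) r / w r) - visitProb w g (g + N) k r / w r) := by
    intro k hk
    rw [Finset.mem_Ico] at hk
    have h1 := hw k (by omega)
    have h2 := hw r hr
    rw [visitProb_eq (k := k) (r := r) (by omega)]
    field_simp
    ring
  rw [Finset.sum_congr rfl key, Finset.sum_add_distrib, Finset.sum_neg_distrib,
    Finset.sum_Ico_sub (fun k => visitProb w g (g + N) k r / w r) (by omega), hz]
  simp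

lemma sum_visitProb_top (hw : ∀ k, 1 ≤ k → 0 < w k) {a b : ℕ} (ha : 1 ≤ a) (hb : 1 ≤ b)
    (hag : a ≤ g) (hbN : b ≤ N) :
    ∑ k ∈ Finset.Ico a (g + 1), visitProb w g (g + N) k N / w k =
      ∑ k ∈ Finset.Ico a (g + 1), visitProb w g (g + N) k b / w k +
        ∑ r ∈ Finset.Ico b N, visitProb w g (g + N) a r / w r := by
  have h : ∑ r ∈ Finset.Ico b N, visitProb w g (g + N) a r / w r =
      ∑ r ∈ Finset.Ico b N, (∑ k ∈ Finset.Ico a (g + 1), visitProb w g (g + N) k (r + 1) / w k -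
        ∑ k ∈ Finset.Ico a (g + 1), visitProb w g (g + N) k r / w k) := by
    refine Finset.sum_congr rfl fun r hr => ?_
    rw [Finset.mem_Ico] at hr
    rw [sum_visitProb_succ hw ha (by omega) hag hr.2]
    ring
  rw [h, Finset.sum_Ico_sub
    (fun r => ∑ k ∈ Finset.Ico a (g + 1), visitProb w g (g + N) k r / w k) hbN]
  ring

lemma visitProb_le (hw : ∀ k, 1 ≤ k → 0 < w k) {a b : ℕ} (ha : 1 ≤ a) (hb : 1 ≤ b)
    (hg : 1 ≤ g) (hbN : b < N) :
    visitProb w g (g + N) a b ≤ w b * (1 / w g + g * (1 / w N)) := by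
  have hwb := hw b hb
  have hwg := hw g hg
  have hwN := hw N (by omega)
  rcases lt_or_ge g a with hga | hag
  · rw [visitProb, hitProb_eq_zero_of_lt _ _ hga]
    positivity
  have hle : visitProb w g (g + N) a b / w b ≤
      ∑ k ∈ Finset.Ico a (g + 1), visitProb w g (g + N) k N / w k := by
    rw [sum_visitProb_top hw ha hb hag hbN.le]
    refine le_add_of_nonneg_of_le (Finset.sum_nonneg fun k hk => ?_) ?_
    · rw [Finset.mem_Ico] at hk
      exact div_nonneg (visitProb_nonneg hw (by omega) hb) (hw k (by omega)).le
    · refine Finset.single_le_sum (f := fun r => visitProb w g (g + N) a r / w r)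
        (fun r hr => ?_) (Finset.mem_Ico.2 ⟨le_rfl, hbN⟩)
      rw [Finset.mem_Ico] at hr
      exact div_nonneg (visitProb_nonneg hw ha (by omega)) (hw r (by omega)).le
  have htop : ∑ k ∈ Finset.Ico a (g + 1), visitProb w g (g + N) k N / w k ≤
      1 / w g + g * (1 / w N) := by
    rw [Finset.sum_Ico_succ_top hag, visitProb_self, add_comm]
    gcongr
    calc _ ≤ ∑ _k ∈ Finset.Ico a g, 1 / w N := Finset.sum_le_sum fun k hk => by
          rw [Finset.mem_Ico] at hk
          exact visitProb_top_le hw (by omega) (by omega) hk.2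
      _ = ((g - a : ℕ) : ℝ) * (1 / w N) := by simp
      _ ≤ _ := by gcongr; omega
  rw [div_le_iff₀' hwb] at hle
  exact hle.trans (by gcongr)

lemma exists_sum_one_div_le (hA0 : Summable fun k : ℕ => 1 / w (k + 1)) :
    ∃ S : ℝ, 0 ≤ S ∧ ∀ s : Finset ℕ, ∑ i ∈ s, 1 / w i ≤ S := by
  have hsum : Summable fun k : ℕ => |1 / w k| := ((summable_nat_add_iff 1).1 hA0).abs
  exact ⟨∑' k, |1 / w k|, tsum_nonneg fun _ => abs_nonneg _, fun s =>
    (Finset.sum_le_sum fun i _ => le_abs_self _).trans (hsum.sum_le_tsum s fun _ _ => abs_nonneg _)⟩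

lemma exists_le_visitProb (hw : ∀ k, 1 ≤ k → 0 < w k) (hA0 : Summable fun k : ℕ => 1 / w (k + 1))
    {a b : ℕ} (ha : 1 ≤ a) (hb : 1 ≤ b) :
    ∃ c : ℝ, 0 < c ∧ ∀ g N, a ≤ g → b ≤ N → c / w g ≤ visitProb w g (g + N) a b := by
  obtain ⟨S, hS0, hpart⟩ := exists_sum_one_div_le hA0
  have hwa := hw a ha
  have hwb := hw b hb
  set K := Real.exp (w b * S) * S + Real.exp (w a * S) * S + 1
  have hK : 0 < K := by positivity
  refine ⟨1 / K, by positivity, fun g N hag hbN => ?_⟩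
  have hwg := hw g (by omega)
  have hp : 0 ≤ visitProb w g (g + N) a b := visitProb_nonneg hw ha hb
  have hleft : ∀ k ∈ Finset.Ico a (g + 1), visitProb w g (g + N) k b / w k ≤
      Real.exp (w b * S) * visitProb w g (g + N) a b * (1 / w k) := by
    intro k hk
    rw [Finset.mem_Ico] at hk
    have hwk := hw k (by omega)
    rw [div_eq_mul_one_div]
    gcongr
    refine le_exp_mul_of_mul_exp_neg_sum_le hwb.le (visitProb_nonneg hw (by omega) hb)
      (hpart (Finset.Ico a k)) ?_
    exact mul_exp_neg_sum_le (f := fun k => visitProb w g (g + N) k b) hk.1 fun i hi hik =>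
      visitProb_succ_left_mul_exp_le hw (by omega) hb (by omega)
  have hright : ∀ r ∈ Finset.Ico b N, visitProb w g (g + N) a r / w r ≤
      Real.exp (w a * S) * visitProb w g (g + N) a b * (1 / w r) := by
    intro r hr
    rw [Finset.mem_Ico] at hr
    have hwr := hw r (by omega)
    rw [div_eq_mul_one_div]
    gcongr
    refine le_exp_mul_of_mul_exp_neg_sum_le hwa.le (visitProb_nonneg hw ha (by omega))
      (hpart (Finset.Ico b r)) ?_
    exact mul_exp_neg_sum_le (f := fun r => visitProb w g (g + N) a r) hr.1 fun i hi hir =>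
      visitProb_succ_right_mul_exp_le hw ha (by omega) (by omega)
  have htop : 1 / w g ≤ ∑ k ∈ Finset.Ico a (g + 1), visitProb w g (g + N) k N / w k := by
    rw [Finset.sum_Ico_succ_top hag, visitProb_self]
    refine le_add_of_nonneg_left (Finset.sum_nonneg fun k hk => ?_)
    rw [Finset.mem_Ico] at hk
    exact div_nonneg (visitProb_nonneg hw (by omega) (by omega)) (hw k (by omega)).le
  rw [sum_visitProb_top hw ha hb hag hbN] at htop
  have hleft_sum := Finset.sum_le_sum hleft
  have hright_sum := Finset.sum_le_sum hright
  rw [← Finset.mul_sum] at hleft_sum hright_sum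
  have hfin : 1 / w g ≤ K * visitProb w g (g + N) a b := by
    have h1 := mul_le_mul_of_nonneg_left (hpart (Finset.Ico a (g + 1)))
      (mul_nonneg (Real.exp_pos (w b * S)).le hp)
    have h2 := mul_le_mul_of_nonneg_left (hpart (Finset.Ico b N))
      (mul_nonneg (Real.exp_pos (w a * S)).le hp)
    simp only [K]
    linarith
  rw [div_div, mul_comm, ← div_div, div_le_iff₀ hK]
  linarith

end visitProb

section law

variable {w : ℕ → ℝ} {a b : ℕ} {P : Measure (ℕ → Bool)}

lemma stepProb_congr {s t : ℕ → Bool} {i : ℕ} (h : ∀ j ≤ i, s j = t j) :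
    stepProb w a b s i = stepProb w a b t i := by
  rw [stepProb, stepProb, Gw_congr a fun j hj => h j hj.le, Rw_congr b fun j hj => h j hj.le,
    h i le_rfl]

lemma IsTwoEdgeLaw.cylinder_real [IsProbabilityMeasure P] (hP : IsTwoEdgeLaw w a b P)
    (Q : ℕ → ℕ → Prop) (n m : ℕ) (s : ℕ → Bool) :
    P.real {ω | (∀ i < m, ω i = s i) ∧ Q (Gw a ω (m + n)) (Rw b ω (m + n))} =
      (∏ i ∈ Finset.range m, stepProb w a b s i) * hitProb w Q n (Gw a s m) (Rw b s m) := by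
  induction n generalizing m s with
  | zero =>
    have h : {ω : ℕ → Bool | (∀ i < m, ω i = s i) ∧ Q (Gw a ω (m + 0)) (Rw b ω (m + 0))} =
        {ω | (∀ i < m, ω i = s i) ∧ Q (Gw a s m) (Rw b s m)} := by
      ext ω
      refine and_congr_right fun h => ?_
      rw [add_zero, Gw_congr a h, Rw_congr b h]
    rw [h, hitProb]
    by_cases hQ : Q (Gw a s m) (Rw b s m)
    · simpa [hQ, measureReal_def] using hP m s
    · simp [hQ]
  | succ n ih =>
    have hlt : ∀ v : Bool, ∀ i < m, Function.update s m v i = s i := fun v i hi =>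
      Function.update_of_ne hi.ne _ _
    have hsplit : ∀ v : Bool,
        P.real {ω | (∀ i < m + 1, ω i = Function.update s m v i) ∧
            Q (Gw a ω (m + 1 + n)) (Rw b ω (m + 1 + n))} =
          (∏ i ∈ Finset.range m, stepProb w a b s i) *
            (stepProb w a b (Function.update s m v) m *
              hitProb w Q n (Gw a s m + if v = true then 1 else 0)
                (Rw b s m + if v = true then 0 else 1)) := by
      intro v
      rw [ih, Gw_succ, Rw_succ, Gw_congr a (hlt v), Rw_congr b (hlt v), Function.update_self,
        Finset.prod_range_succ, mul_assoc]
      congr 1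
      exact Finset.prod_congr rfl fun i hi => stepProb_congr fun j hj =>
        hlt v j (hj.trans_lt (Finset.mem_range.1 hi))
    have hset : ∀ v : Bool, {ω : ℕ → Bool | (∀ i < m + 1, ω i = Function.update s m v i) ∧
            Q (Gw a ω (m + 1 + n)) (Rw b ω (m + 1 + n))} =
        {ω | (∀ i < m, ω i = s i) ∧ Q (Gw a ω (m + (n + 1))) (Rw b ω (m + (n + 1)))} ∩
          {ω | ω m = v} := by
      intro v
      ext ω
      have h : (∀ i < m + 1, ω i = Function.update s m v i) ↔
          (∀ i < m, ω i = s i) ∧ ω m = v := by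
        rw [Nat.forall_lt_succ_right, Function.update_self]
        refine and_congr_left fun _ => forall₂_congr fun i hi => ?_
        rw [Function.update_of_ne hi.ne]
      simp only [Set.mem_ofPred_eq, Set.mem_inter_iff, h, add_assoc, add_comm 1 n]
      tauto
    have hmeas : MeasurableSet {ω : ℕ → Bool | ω m = true} :=
      measurableSet_eq_fun (measurable_pi_apply m) measurable_const
    have hcompl : {ω : ℕ → Bool | ω m = true}ᶜ = {ω | ω m = false} := by ext; simp
    rw [← measureReal_inter_add_sdiff hmeas, Set.sdiff_eq, hcompl, ← hset, ← hset, hsplit, hsplit,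
      ← mul_add, hitProb]
    congr 1
    simp only [stepProb, Gw_congr a (hlt _), Rw_congr b (hlt _), Function.update_self, if_true,
      Bool.false_eq_true, if_false, add_zero]
    ring

lemma IsTwoEdgeLaw.real_eq_hitProb [IsProbabilityMeasure P] (hP : IsTwoEdgeLaw w a b P)
    (Q : ℕ → ℕ → Prop) (n : ℕ) :
    P.real {ω | Q (Gw a ω n) (Rw b ω n)} = hitProb w Q n a b := by
  simpa [Gw, Rw, greenCount] using hP.cylinder_real Q n 0 fun _ => true

lemma IsTwoEdgeLaw.real_Gw_eq [IsProbabilityMeasure P] (hP : IsTwoEdgeLaw w a b P) {g N n : ℕ}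
    (h : n + (a + b) = g + N) :
    P.real {ω | Gw a ω n = g} = visitProb w g (g + N) a b := by
  rw [hP.real_eq_hitProb (fun x _ => x = g), visitProb, ← h, Nat.add_sub_cancel]

lemma IsTwoEdgeLaw.real_Rw_eq [IsProbabilityMeasure P] (hP : IsTwoEdgeLaw w a b P) {g N n : ℕ}
    (h : n + (a + b) = g + N) :
    P.real {ω | Rw b ω n = g} = visitProb w g (g + N) b a := by
  rw [hP.real_eq_hitProb (fun _ y => y = g), visitProb, ← h, add_comm b a, Nat.add_sub_cancel,
    ← hitProb_swap]

lemma Zinf_eq_iSup (a b : ℕ) (ω : ℕ → Bool) :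
    Zinf a b ω = ⨆ n, ((min (Gw a ω n) (Rw b ω n) : ℕ) : ℕ∞) := by
  refine le_antisymm (iSup_le fun n => le_iSup_of_le (n - (a + b)) le_rfl)
    (iSup_le fun n => le_iSup_of_le (n + (a + b)) ?_)
  rw [Z, Nat.add_sub_cancel]

lemma monotone_min_Gw_Rw (a b : ℕ) (ω : ℕ → Bool) :
    Monotone fun n => min (Gw a ω n) (Rw b ω n) := by
  refine monotone_nat_of_le_succ fun n => ?_
  rw [Gw_succ, Rw_succ]
  exact min_le_min (Nat.le_add_right _ _) (Nat.le_add_right _ _)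

lemma eventually_min_eq_iff (a b ℓ : ℕ) (ω : ℕ → Bool) :
    ∀ᶠ n in Filter.atTop, min (Gw a ω n) (Rw b ω n) = ℓ ↔ Zinf a b ω = ℓ := by
  have hmono := monotone_min_Gw_Rw a b ω
  rw [Zinf_eq_iSup]
  set X := fun n => min (Gw a ω n) (Rw b ω n) with hX
  change ∀ᶠ n in Filter.atTop, X n = ℓ ↔ (⨆ n, (X n : ℕ∞)) = ℓ
  have hle : ∀ n, (X n : ℕ∞) ≤ ⨆ n, (X n : ℕ∞) := fun n => le_iSup (fun n => (X n : ℕ∞)) n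
  by_cases hbig : ∃ n, ℓ < X n
  · obtain ⟨n, hn⟩ := hbig
    filter_upwards [Filter.eventually_ge_atTop n] with m hm
    have h1 : ℓ < X m := hn.trans_le (hmono hm)
    refine iff_of_false h1.ne' fun h => ?_
    exact absurd (h ▸ hle m) (not_le.2 (by exact_mod_cast h1))
  push Not at hbig
  have hub : (⨆ n, (X n : ℕ∞)) ≤ ℓ := iSup_le fun n => by exact_mod_cast hbig n
  by_cases heq : ∃ n, X n = ℓ
  · obtain ⟨n, hn⟩ := heq
    filter_upwards [Filter.eventually_ge_atTop n] with m hm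
    refine iff_of_true (le_antisymm (hbig m) (hn ▸ hmono hm)) (le_antisymm hub ?_)
    exact hn ▸ hle n
  · push Not at heq
    refine Filter.Eventually.of_forall fun m => iff_of_false (heq m) fun h => ?_
    have hlt : ∀ n, X n + 1 ≤ ℓ := fun n => lt_of_le_of_ne (hbig n) (heq n)
    have h2 : (⨆ n, (X n : ℕ∞)) ≤ ((ℓ - 1 : ℕ) : ℕ∞) := iSup_le fun n => by
      have := hlt n
      exact_mod_cast (by omega : X n ≤ ℓ - 1)
    rw [h] at h2
    have h3 : ℓ ≤ ℓ - 1 := by exact_mod_cast h2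
    have := hlt 0
    omega

lemma tendsto_real_min_eq [IsProbabilityMeasure P] (a b ℓ : ℕ) :
    Filter.Tendsto (fun n => P.real {ω | min (Gw a ω n) (Rw b ω n) = ℓ}) Filter.atTop
      (nhds (P.real {ω | Zinf a b ω = ℓ})) := by
  refine (ENNReal.tendsto_toReal (measure_ne_top _ _)).comp ?_
  refine tendsto_measure_of_tendsto_indicator_of_isFiniteMeasure Filter.atTop P ?_ ?_
  · intro n
    have hG : Measurable fun ω : ℕ → Bool => Gw a ω n :=
      (measurable_greenCount n).const_add a
    have hR : Measurable fun ω : ℕ → Bool => Rw b ω n :=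
      ((measurable_greenCount n).const_sub n).const_add b
    exact (hG.min hR) (measurableSet_singleton ℓ)
  · intro ω
    exact eventually_min_eq_iff a b ℓ ω

end law

end AttractionTime

/-- Corollary 5: under (A0), for `P = P^{a,b}` there are
constants `0 < c ≤ C < ∞` with `c/w(ℓ) ≤ P(Z_∞ = ℓ) ≤ C/w(ℓ)` for every
`ℓ ≥ min(a,b)`. -/
theorem stmt5 (w : ℕ → ℝ) (hw : ∀ k, 1 ≤ k → 0 < w k)
    (hA0 : Summable fun k : ℕ => 1 / w (k + 1))
    (a b : ℕ) (ha : 1 ≤ a) (hb : 1 ≤ b)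
    (P : Measure (ℕ → Bool)) [IsProbabilityMeasure P]
    (hP : IsTwoEdgeLaw w a b P) :
    ∃ c C : ℝ, 0 < c ∧ c ≤ C ∧
      ∀ ℓ : ℕ, min a b ≤ ℓ →
        c / w ℓ ≤ (P {ω | Zinf a b ω = (ℓ : ℕ)}).toReal ∧
          (P {ω | Zinf a b ω = (ℓ : ℕ)}).toReal ≤ C / w ℓ := by
  have htend : Filter.Tendsto (fun n => 1 / w n) Filter.atTop (nhds 0) :=
    ((summable_nat_add_iff 1).1 hA0).tendsto_atTop_zero
  obtain ⟨c₁, hc₁, hG⟩ := exists_le_visitProb hw hA0 ha hb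
  obtain ⟨c₂, hc₂, hR⟩ := exists_le_visitProb hw hA0 hb ha
  have hwa := hw a ha
  have hwb := hw b hb
  refine ⟨min c₁ c₂, max (min c₁ c₂) (w b + w a), by positivity, le_max_left _ _, fun ℓ hℓ => ?_⟩
  have hℓ1 : 1 ≤ ℓ := by omega
  have hwℓ := hw ℓ hℓ1
  have hlim := tendsto_real_min_eq (P := P) a b ℓ
  constructor
  · refine ge_of_tendsto hlim ?_
    filter_upwards [Filter.eventually_ge_atTop (2 * ℓ + a + b)] with n hn
    have hN : n + (a + b) = ℓ + (n + (a + b) - ℓ) := by omega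
    rcases min_le_iff.1 hℓ with h | h
    · calc _ ≤ c₁ / w ℓ := by gcongr; exact min_le_left _ _
        _ ≤ _ := hG ℓ (n + (a + b) - ℓ) h (by omega)
        _ = _ := (hP.real_Gw_eq hN).symm
        _ ≤ _ := measureReal_mono fun ω (hω : Gw a ω n = ℓ) => by
          have := Gw_add_Rw a b ω n
          change min _ _ = ℓ
          omega
    · calc _ ≤ c₂ / w ℓ := by gcongr; exact min_le_right _ _
        _ ≤ _ := hR ℓ (n + (a + b) - ℓ) h (by omega)
        _ = _ := (hP.real_Rw_eq hN).symm
        _ ≤ _ := measureReal_mono fun ω (hω : Rw b ω n = ℓ) => by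
          have := Gw_add_Rw a b ω n
          change min _ _ = ℓ
          omega
  · have hlim' : Filter.Tendsto (fun n => (w b + w a) * (1 / w ℓ + ℓ * (1 / w (n + (a + b) - ℓ))))
        Filter.atTop (nhds ((w b + w a) * (1 / w ℓ + ℓ * 0))) := by
      refine ((htend.comp ?_).const_mul _ |>.const_add _).const_mul _
      refine Filter.tendsto_atTop_atTop.2 fun m => ⟨m + ℓ, fun n hn => ?_⟩
      omega
    calc _ ≤ (w b + w a) * (1 / w ℓ + ℓ * 0) := by
          refine le_of_tendsto_of_tendsto hlim hlim' ?_
          filter_upwards [Filter.eventually_ge_atTop (ℓ + a + b)] with n hn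
          have hN : n + (a + b) = ℓ + (n + (a + b) - ℓ) := by omega
          calc _ ≤ P.real ({ω | Gw a ω n = ℓ} ∪ {ω | Rw b ω n = ℓ}) :=
                measureReal_mono fun ω (hω : min (Gw a ω n) (Rw b ω n) = ℓ) => by
                  change Gw a ω n = ℓ ∨ Rw b ω n = ℓ
                  omega
            _ ≤ _ := measureReal_union_le _ _
            _ ≤ _ := by
              rw [hP.real_Gw_eq hN, hP.real_Rw_eq hN, add_mul]
              exact add_le_add (visitProb_le hw ha hb hℓ1 (by omega))
                (visitProb_le hw hb ha hℓ1 (by omega))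
      _ = (w b + w a) / w ℓ := by ring
      _ ≤ _ := by gcongr; exact le_max_right _ _
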